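/- (Gallai's Lemma) If G is a finite simple connected graph such that ν(G \ v) = ν(G) for every vertex v (where G \ v denotes the induced subgraph on V(G) minus v), then |V(G)| = 2ν(G) + 1. -/

import Mathlib

open SimpleGraph

/-- `M` is a matching of `G`: a set of edges of `G` that are pairwise vertex-disjoint. -/
def IsMatchingSet {V : Type} (G : SimpleGraph V) (M : Set (Sym2 V)) : Prop :=
  M ⊆ G.edgeSet ∧ M.Pairwise fun e f => ∀ v : V, v ∈ e → v ∉ f

/-- The matching number `ν(G)`: the maximum size of a matching in `G`. -/
noncomputable def nu {V : Type} (G : SimpleGraph V) : ℕ :=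
  sSup {n | ∃ M : Set (Sym2 V), IsMatchingSet G M ∧ M.ncard = n}

/-- `v` is saturated (covered) by the matching `M`. -/
def MSaturates {V : Type} (M : Set (Sym2 V)) (v : V) : Prop := ∃ e ∈ M, v ∈ e

/-- The edges of the walk `p` alternate: the `i`-th edge belongs to `M` iff `i` is odd
(so the walk starts with a non-matching edge). -/
def IsAlternating {V : Type} (M : Set (Sym2 V)) {G : SimpleGraph V} {a b : V}
    (p : G.Walk a b) : Prop :=
  ∀ (i : ℕ) (h : i < p.edges.length), (p.edges[i]'h ∈ M ↔ Odd i)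

/-- A star path of `G` relative to `M`: a path of even length, alternating starting with a
non-matching edge, whose initial vertex is `M`-unsaturated. -/
def IsStarPath {V : Type} (M : Set (Sym2 V)) {G : SimpleGraph V} {a b : V}
    (p : G.Walk a b) : Prop :=
  p.IsPath ∧ Even p.length ∧ ¬ MSaturates M a ∧ IsAlternating M p

/-- `v` is a star vertex of `G` relative to `M`: some star path terminates at `v`. -/
def IsStarVertex {V : Type} (G : SimpleGraph V) (M : Set (Sym2 V)) (v : V) : Prop :=
  ∃ a : V, ∃ p : G.Walk a v, IsStarPath M p

/-- An `M`-augmenting path: a path of odd length, alternating starting and ending with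
non-matching edges, both of whose endpoints are `M`-unsaturated. -/
def IsAugPath {V : Type} (M : Set (Sym2 V)) {G : SimpleGraph V} {a b : V}
    (p : G.Walk a b) : Prop :=
  p.IsPath ∧ Odd p.length ∧ ¬ MSaturates M a ∧ ¬ MSaturates M b ∧ IsAlternating M p

/-- `G ∈ F(d,m)`: `G` is a finite simple graph with maximum degree `< d` and matching
number `< m`, edge-maximal with this property among all finite graphs on vertex sets
containing `V(G)`. -/
def MemF (d m : ℕ) {V : Type} [Fintype V] (G : SimpleGraph V) : Prop :=
  (∀ v : V, (G.neighborSet v).ncard < d) ∧ nu G < m ∧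
  ∀ (W : Type) [Fintype W] (f : V ↪ W) (G' : SimpleGraph W),
    (∀ u v : V, G.Adj u v → G'.Adj (f u) (f v)) →
    G.edgeSet.ncard < G'.edgeSet.ncard →
    (∃ w : W, d ≤ (G'.neighborSet w).ncard) ∨ m ≤ nu G'

variable {V : Type}

theorem IsMatchingSet.ncard_le_nu [Finite V] {G : SimpleGraph V} {M : Set (Sym2 V)}
    (hM : IsMatchingSet G M) : M.ncard ≤ nu G :=
  le_csSup ⟨Nat.card (Sym2 V), by rintro n ⟨M, -, rfl⟩; exact Set.ncard_le_card M⟩ ⟨M, hM, rfl⟩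

theorem exists_isMatchingSet_ncard_eq_nu [Finite V] (G : SimpleGraph V) :
    ∃ M, IsMatchingSet G M ∧ M.ncard = nu G :=
  Nat.sSup_mem (s := {n | ∃ M : Set (Sym2 V), IsMatchingSet G M ∧ M.ncard = n})
    ⟨0, ∅, ⟨Set.empty_subset _, Set.pairwise_empty _⟩, Set.ncard_empty _⟩
    ⟨Nat.card (Sym2 V), by rintro n ⟨M, -, rfl⟩; exact Set.ncard_le_card M⟩

theorem IsMatchingSet.mono {G : SimpleGraph V} {M N : Set (Sym2 V)}
    (hM : IsMatchingSet G M) (h : N ⊆ M) : IsMatchingSet G N :=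
  ⟨h.trans hM.1, hM.2.mono h⟩

theorem IsMatchingSet.ncard_saturated [Finite V] {G : SimpleGraph V} {M : Set (Sym2 V)}
    (hM : IsMatchingSet G M) : {v | MSaturates M v}.ncard = 2 * M.ncard := by
  classical
  have := Fintype.ofFinite V
  have hset : {v | MSaturates M v} = (M.toFinset.biUnion Sym2.toFinset : Finset V) := by
    ext v
    simp [MSaturates]
  rw [hset, Set.ncard_coe_finset, Finset.card_biUnion, Set.ncard_eq_toFinset_card', mul_comm]
  · refine Finset.sum_const_nat fun e he => ?_
    exact Sym2.card_toFinset_of_not_isDiag e (G.not_isDiag_of_mem_edgeSet (hM.1 (by simpa using he)))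
  · intro e he f hf hef
    rw [Function.onFun, Finset.disjoint_left]
    intro v hv hv'
    exact hM.2 (by simpa using he) (by simpa using hf) hef v (by simpa using hv) (by simpa using hv')

theorem IsMatchingSet.insert {G : SimpleGraph V} {M : Set (Sym2 V)} (hM : IsMatchingSet G M)
    {u v : V} (huv : G.Adj u v) (hu : ¬ MSaturates M u) (hv : ¬ MSaturates M v) :
    IsMatchingSet G (insert s(u, v) M) := by
  refine ⟨Set.insert_subset huv hM.1, hM.2.insert fun f hf _ => ⟨fun w hw hwf => ?_, fun w hwf hw => ?_⟩⟩ <;>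
  · rcases Sym2.mem_iff.1 hw with rfl | rfl
    exacts [hu ⟨f, hf, hwf⟩, hv ⟨f, hf, hwf⟩]

theorem exists_isMatchingSet_not_mSaturates [Finite V] {G : SimpleGraph V} {v : V}
    (hv : nu (G.induce ({v}ᶜ : Set V)) = nu G) :
    ∃ M, IsMatchingSet G M ∧ M.ncard = nu G ∧ ¬ MSaturates M v := by
  obtain ⟨M, hM, hcard⟩ := exists_isMatchingSet_ncard_eq_nu (G.induce ({v}ᶜ : Set V))
  have hinj := Sym2.map.injective (Subtype.val_injective (p := (· ∈ ({v}ᶜ : Set V))))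
  refine ⟨Sym2.map Subtype.val '' M, ⟨?_, ?_⟩, ?_, ?_⟩
  · rintro _ ⟨e, he, rfl⟩
    have := hM.1 he
    induction e with | _ a b => simpa using this
  · rintro _ ⟨e, he, rfl⟩ _ ⟨f, hf, rfl⟩ hef w hwe hwf
    obtain ⟨a, ha, rfl⟩ := Sym2.mem_map.1 hwe
    obtain ⟨b, hb, hab⟩ := Sym2.mem_map.1 hwf
    obtain rfl := Subtype.val_injective hab
    exact hM.2 he hf (fun h => hef (h ▸ rfl)) _ ha hb
  · rw [Set.ncard_image_of_injective _ hinj, hcard, hv]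
  · rintro ⟨_, ⟨e, he, rfl⟩, hve⟩
    obtain ⟨a, -, ha⟩ := Sym2.mem_map.1 hve
    exact a.2 ha

/-- The edges of `N` inside `C` together with the edges of `M` outside `C`. -/
def exchange (M N : Set (Sym2 V)) (C : Set V) : Set (Sym2 V) :=
  {e ∈ M | ∀ x ∈ e, x ∉ C} ∪ {e ∈ N | ∀ x ∈ e, x ∈ C}

theorem IsMatchingSet.exchange {G : SimpleGraph V} {M N : Set (Sym2 V)} (hM : IsMatchingSet G M)
    (hN : IsMatchingSet G N) (C : Set V) : IsMatchingSet G (exchange M N C) := by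
  refine ⟨?_, ?_⟩
  · rintro e (he | he)
    exacts [hM.1 he.1, hN.1 he.1]
  · rintro e (he | he) f (hf | hf) hef v hve hvf
    · exact hM.2 he.1 hf.1 hef v hve hvf
    · exact he.2 v hve (hf.2 v hvf)
    · exact hf.2 v hvf (he.2 v hve)
    · exact hN.2 he.1 hf.1 hef v hve hvf

theorem ncard_exchange_add_ncard_exchange [Finite V] {M N : Set (Sym2 V)} {C : Set V}
    (hM : ∀ a b, s(a, b) ∈ M → (a ∈ C ↔ b ∈ C)) (hN : ∀ a b, s(a, b) ∈ N → (a ∈ C ↔ b ∈ C)) :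
    (exchange M N C).ncard + (exchange N M C).ncard = M.ncard + N.ncard := by
  have hdisj (A B : Set (Sym2 V)) :
      Disjoint {e ∈ A | ∀ x ∈ e, x ∉ C} {e ∈ B | ∀ x ∈ e, x ∈ C} := by
    rw [Set.disjoint_left]
    rintro e ⟨-, h⟩ ⟨-, h'⟩
    induction e with | _ a b => exact h a (by simp) (h' a (by simp))
  have hsplit {A : Set (Sym2 V)} (hA : ∀ a b, s(a, b) ∈ A → (a ∈ C ↔ b ∈ C)) :
      A.ncard = {e ∈ A | ∀ x ∈ e, x ∉ C}.ncard + {e ∈ A | ∀ x ∈ e, x ∈ C}.ncard := by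
    rw [← Set.ncard_union_eq (hdisj A A)]
    congr 1
    ext e
    induction e with | _ a b =>
    have := hA a b
    simp
    tauto
  rw [hsplit hM, hsplit hN, exchange, exchange, Set.ncard_union_eq (hdisj _ _),
    Set.ncard_union_eq (hdisj _ _)]
  omega

/-- A connected component of the union of two matchings has at most two vertices missed by one of
them, counted with multiplicity. -/
theorem IsMatchingSet.not_mem_supp_of_not_mSaturates [Finite V] {G : SimpleGraph V}
    {M N : Set (Sym2 V)} (hM : IsMatchingSet G M) (hN : IsMatchingSet G N)
    (c : (fromEdgeSet (M ∪ N)).ConnectedComponent) {u v w : V} (huw : u ≠ w)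
    (hu : ¬ MSaturates M u) (hw : ¬ MSaturates M w) (hv : ¬ MSaturates N v)
    (huc : u ∈ c.supp) (hvc : v ∈ c.supp) : w ∉ c.supp := by
  intro hwc
  have hcount {A : Set (Sym2 V)} (hA : IsMatchingSet G A) {D : Set V} (hD : D ⊆ c.supp)
      (hAD : ∀ x ∈ D, ¬ MSaturates A x) :
      2 * {e ∈ A | ∀ x ∈ e, x ∈ c.supp}.ncard + D.ncard ≤ c.supp.ncard := by
    rw [← (hA.mono (Set.sep_subset _ _)).ncard_saturated, ← Set.ncard_union_eq]
    · refine Set.ncard_le_ncard (Set.union_subset ?_ hD)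
      rintro x ⟨e, he, hx⟩
      exact he.2 x hx
    · rw [Set.disjoint_left]
      rintro x ⟨e, he, hx⟩ hxD
      exact hAD x hxD ⟨e, he.1, hx⟩
  have h1 := hcount hM (D := {u, w}) (by rintro x (rfl | rfl) <;> assumption)
    (by rintro x (rfl | rfl) <;> assumption)
  have h2 := hcount hN (D := {v}) (by rintro x rfl; assumption) (by rintro x rfl; assumption)
  rw [Set.ncard_pair huw] at h1
  rw [Set.ncard_singleton] at h2
  have h3 := c.connected_toSimpleGraph.card_vert_le_card_edgeSet_add_one
  have h4 : Nat.card c.toSimpleGraph.edgeSet ≤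
      ({e ∈ M | ∀ x ∈ e, x ∈ c.supp} ∪ {e ∈ N | ∀ x ∈ e, x ∈ c.supp}).ncard := by
    rw [Nat.card_coe_set_eq]
    refine Set.ncard_le_ncard_of_injOn (Sym2.map Subtype.val) ?_
      (Sym2.map.injective Subtype.val_injective).injOn
    intro e he
    induction e with | _ a b =>
    have hab : s(a.1, b.1) ∈ M ∪ N := ((fromEdgeSet_adj _).1 he).1
    have hmem : ∀ x ∈ s(a.1, b.1), x ∈ c.supp := by
      intro x hx
      rcases Sym2.mem_iff.1 hx with rfl | rfl
      exacts [a.2, b.2]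
    exact hab.imp (⟨·, hmem⟩) (⟨·, hmem⟩)
  have h5 := Set.ncard_union_le {e ∈ M | ∀ x ∈ e, x ∈ c.supp} {e ∈ N | ∀ x ∈ e, x ∈ c.supp}
  have h6 : Nat.card c = c.supp.ncard := Nat.card_coe_set_eq _
  omega

/-- No maximum matching of `G` misses both `u` and `v`. -/
def NotBothMissed (G : SimpleGraph V) (u v : V) : Prop :=
  ∀ M, IsMatchingSet G M → M.ncard = nu G → MSaturates M u ∨ MSaturates M v

theorem NotBothMissed.symm {G : SimpleGraph V} {u v : V} (h : NotBothMissed G u v) :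
    NotBothMissed G v u :=
  fun M hM hcard => (h M hM hcard).symm

theorem SimpleGraph.Adj.notBothMissed [Finite V] {G : SimpleGraph V} {u v : V} (h : G.Adj u v) :
    NotBothMissed G u v := by
  intro M hM hcard
  by_contra! hmiss
  have hle := (hM.insert h hmiss.1 hmiss.2).ncard_le_nu
  rw [Set.ncard_insert_of_notMem fun hmem => hmiss.1 ⟨_, hmem, Sym2.mem_mk_left u v⟩] at hle
  omega

/-- If `M` misses `u`, `N` misses `v` and both are maximum, then exchanging along the component of
`v` gives a maximum matching missing `v`, so that this component must contain `u`. -/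
theorem NotBothMissed.mem_supp [Finite V] {G : SimpleGraph V} {u v : V}
    (h : NotBothMissed G u v) {M N : Set (Sym2 V)} (hM : IsMatchingSet G M)
    (hN : IsMatchingSet G N) (hMc : M.ncard = nu G) (hNc : N.ncard = nu G)
    (hu : ¬ MSaturates M u) (hv : ¬ MSaturates N v) :
    u ∈ ((fromEdgeSet (M ∪ N)).connectedComponentMk v).supp := by
  set c := (fromEdgeSet (M ∪ N)).connectedComponentMk v
  by_contra huc
  have hclosed (a b : V) (hab : s(a, b) ∈ M ∪ N) : a ∈ c.supp ↔ b ∈ c.supp := by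
    have hG : G.Adj a b := hab.elim (hM.1 ·) (hN.1 ·)
    exact c.mem_supp_congr_adj ((fromEdgeSet_adj _).2 ⟨hab, hG.ne⟩)
  have hsum := ncard_exchange_add_ncard_exchange (C := c.supp)
    (fun a b hab => hclosed a b (.inl hab)) (fun a b hab => hclosed a b (.inr hab))
  have h1 := (hM.exchange hN c.supp).ncard_le_nu
  have h2 := (hN.exchange hM c.supp).ncard_le_nu
  rcases h _ (hM.exchange hN c.supp) (by omega) with ⟨e, he | he, hx⟩ | ⟨e, he | he, hx⟩
  · exact hu ⟨e, he.1, hx⟩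
  · exact huc (he.2 u hx)
  · exact he.2 v hx rfl
  · exact hv ⟨e, he.1, hx⟩

theorem NotBothMissed.trans [Finite V] {G : SimpleGraph V} {u v w : V}
    (hfc : nu (G.induce ({v}ᶜ : Set V)) = nu G) (huv : NotBothMissed G u v)
    (hvw : NotBothMissed G v w) (huw : u ≠ w) : NotBothMissed G u w := by
  intro M hM hMc
  by_contra! hmiss
  obtain ⟨N, hN, hNc, hv⟩ := exists_isMatchingSet_not_mSaturates hfc
  exact hM.not_mem_supp_of_not_mSaturates hN _ huw hmiss.1 hmiss.2 hv
    (huv.mem_supp hM hN hMc hNc hmiss.1 hv) rfl (hvw.symm.mem_supp hM hN hMc hNc hmiss.2 hv)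

theorem SimpleGraph.Walk.notBothMissed [Finite V] {G : SimpleGraph V}
    (hfc : ∀ v : V, nu (G.induce ({v}ᶜ : Set V)) = nu G) {u v : V} (p : G.Walk u v)
    (huv : u ≠ v) : NotBothMissed G u v := by
  induction p with
  | nil => exact absurd rfl huv
  | @cons u x v h p ih =>
    obtain rfl | hxv := eq_or_ne x v
    · exact h.notBothMissed
    · exact h.notBothMissed.trans (hfc x) (ih hxv) huv

/-- Gallai's Lemma: a connected factor-critical graph has `2ν(G) + 1`
vertices. -/
theorem stmt_6 {V : Type} [Fintype V] (G : SimpleGraph V) (hconn : G.Connected)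
    (hfc : ∀ v : V, nu (G.induce ({v}ᶜ : Set V)) = nu G) :
    Fintype.card V = 2 * nu G + 1 := by
  obtain ⟨v⟩ := hconn.nonempty
  obtain ⟨M, hM, hcard, hv⟩ := exists_isMatchingSet_not_mSaturates (hfc v)
  have hsat : {u | MSaturates M u} = {v}ᶜ := by
    ext u
    refine ⟨fun hu huv => hv (huv ▸ hu), fun huv => ?_⟩
    obtain ⟨p⟩ := hconn.preconnected u v
    exact (p.notBothMissed hfc huv M hM hcard).resolve_right hv
  have hsum := Set.ncard_add_ncard_compl ({v} : Set V)
  rw [← hsat, hM.ncard_saturated, hcard, Set.ncard_singleton, Nat.card_eq_fintype_card] at hsum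
  omega
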